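/- Fix n and a real α ≥ 1, and let M be a randomized allocation rule all of whose output allocations lie in the family 𝒳. Suppose that for every v ∈ {1,α}^n, Pr[U(v) and not B | v] ≤ (ln 4)·e^(−n^(1/4)/2). Then (1/(2n))·Σ_{i=1}^n p_i^1(α) ≤ 3·n^(−1/4) + Pr[B] + (ln 4)·e^(−n^(1/4)/2) + 2·e^(−n^(1/4)/4). -/

import Mathlib

/-!
Statement 11 (Lemma "one-alpha"): for any randomized allocation rule `M` whose
output allocations all lie in the family `𝒳`, if for every `v` the conditional
probability `Pr[U(v) ∧ ¬B | v]` is at most `(ln 4)·e^{−n^{1/4}/2}`, then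
`(1/(2n))·Σ_i p_i^1(α) ≤ 3·n^{−1/4} + Pr[B] + (ln 4)·e^{−n^{1/4}/2}
  + 2e^{−n^{1/4}/4}`.
Speed vectors `v ∈ {1,α}^n` are encoded by the high-speed set `H = {i : v_i = α}`,
uniform over subsets; the rule's internal randomness is a finite space `(Ω,μ)`.
-/

open Finset
open scoped Classical

noncomputable section

/-- Real-valued indicator of a proposition. -/
def ind (P : Prop) : ℝ := if P then 1 else 0

/-- Event `B` at `(H,ω)`: some agent `i` with `v_i = 1` receives allocation `α`. -/
def Bev {n : ℕ} {Ω : Type} (α : ℝ) (M : Finset (Fin n) → Ω → Fin n → ℝ)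
    (H : Finset (Fin n)) (ω : Ω) : Prop :=
  ∃ i, i ∉ H ∧ M H ω i = α

/-- Event `U(v)` at `(H,ω)`: at least `n^{3/4}` agents `i` have `v_i = 1` and `x_i = 0`. -/
def Uev {n : ℕ} {Ω : Type} (M : Finset (Fin n) → Ω → Fin n → ℝ)
    (H : Finset (Fin n)) (ω : Ω) : Prop :=
  (n : ℝ) ^ ((3 : ℝ) / 4) ≤
    ((Finset.univ.filter (fun i : Fin n => i ∉ H ∧ M H ω i = 0)).card : ℝ)

/-- `Pr[B]`, over the uniform random `H` and the randomness of `M`. -/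
def prB {n : ℕ} {Ω : Type} [Fintype Ω] (α : ℝ) (μ : Ω → ℝ)
    (M : Finset (Fin n) → Ω → Fin n → ℝ) : ℝ :=
  (∑ H : Finset (Fin n), ∑ ω : Ω, μ ω * ind (Bev α M H ω)) / 2 ^ n

/-- `p_i^s(α) = Pr[x_i = s | v_i = α]`. -/
def pHigh {n : ℕ} {Ω : Type} [Fintype Ω] (μ : Ω → ℝ)
    (M : Finset (Fin n) → Ω → Fin n → ℝ) (i : Fin n) (s : ℝ) : ℝ :=
  (∑ H ∈ Finset.univ.filter (fun H : Finset (Fin n) => i ∈ H),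
      ∑ ω : Ω, μ ω * ind (M H ω i = s)) / 2 ^ (n - 1)

/-- The family `𝒳` of allocations: type 1 — given `H'` with
`n/2 − n^{3/4} ≤ |H'| ≤ n/2 + n^{3/4}` and `S ⊆ H'` with `|S| ≤ n^{1/2}`, allocate `α`
on `S`, `0` on `H'∖S` and `1` outside `H'`; type 2 — given `S` with `|S| = n^{3/4}`,
allocate `α` on `S` and `0` elsewhere. -/
def inFam {n : ℕ} (α : ℝ) (x : Fin n → ℝ) : Prop :=
  (∃ H' S : Finset (Fin n), S ⊆ H' ∧
      (n : ℝ) / 2 - (n : ℝ) ^ ((3 : ℝ) / 4) ≤ (H'.card : ℝ) ∧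
      (H'.card : ℝ) ≤ (n : ℝ) / 2 + (n : ℝ) ^ ((3 : ℝ) / 4) ∧
      (S.card : ℝ) ≤ (n : ℝ) ^ ((1 : ℝ) / 2) ∧
      (∀ i, x i = if i ∈ S then α else if i ∈ H' then 0 else 1)) ∨
  (∃ S : Finset (Fin n), (S.card : ℝ) = (n : ℝ) ^ ((3 : ℝ) / 4) ∧
      (∀ i, x i = if i ∈ S then α else 0))

lemma ind_nonneg' (P : Prop) : 0 ≤ ind P := by unfold ind; split_ifs <;> norm_num

lemma ind_le_one' (P : Prop) : ind P ≤ 1 := by unfold ind; split_ifs <;> norm_num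

/-- Event not-C, with `t = n^{1/4}`. -/
def badC {n : ℕ} (t : ℝ) (H : Finset (Fin n)) : Prop :=
  ¬ ((n : ℝ) / 2 - t ^ 3 ≤ (H.card : ℝ) ∧ (H.card : ℝ) ≤ (n : ℝ) / 2 + t ^ 3)

lemma mgf_sum (n : ℕ) (l : ℝ) :
    ∑ H : Finset (Fin n), Real.exp (l * (2 * (H.card : ℝ) - n)) ≤
      2 ^ n * Real.exp (n * (l ^ 2 / 2)) := by
  have h := Finset.sum_pow_mul_eq_add_pow (Real.exp l) (Real.exp (-l)) (univ : Finset (Fin n))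
  rw [Finset.powerset_univ, Finset.card_univ, Fintype.card_fin] at h
  have h2 : ∑ H : Finset (Fin n), Real.exp (l * (2 * (H.card : ℝ) - n)) =
      (Real.exp l + Real.exp (-l)) ^ n := by
    rw [← h]
    refine Finset.sum_congr rfl fun H _ => ?_
    have hc : H.card ≤ n := by simpa using Finset.card_le_univ H
    rw [← Real.exp_nat_mul, ← Real.exp_nat_mul, ← Real.exp_add, Nat.cast_sub hc]
    congr 1; ring
  rw [h2]
  have h3 : Real.exp l + Real.exp (-l) ≤ 2 * Real.exp (l ^ 2 / 2) := by
    have := Real.cosh_le_exp_half_sq l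
    rw [Real.cosh_eq] at this; linarith
  calc (Real.exp l + Real.exp (-l)) ^ n ≤ (2 * Real.exp (l ^ 2 / 2)) ^ n := by
        gcongr
    _ = _ := by rw [mul_pow, ← Real.exp_nat_mul]

lemma badC_sum (n : ℕ) (t : ℝ) (ht : 1 ≤ t) (hn : (n : ℝ) = t ^ 4) :
    ∑ H : Finset (Fin n), ind (badC t H) ≤ 2 ^ n * (2 * Real.exp (-t / 4)) := by
  have ht0 : 0 < t := by linarith
  have hpt : ∀ H : Finset (Fin n), ind (badC t H) ≤
      Real.exp (-2 * t ^ 2) * (Real.exp (1 / t * (2 * (H.card : ℝ) - n)) +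
        Real.exp (-(1 / t) * (2 * (H.card : ℝ) - n))) := by
    intro H
    unfold ind
    split_ifs with hb
    · unfold badC at hb
      rw [not_and_or, not_le, not_le] at hb
      rw [mul_add, ← Real.exp_add, ← Real.exp_add]
      have e : 2 * t ^ 2 = (1 / t) * (2 * t ^ 3) := by field_simp
      have hi : 0 ≤ 1 / t := by positivity
      rcases hb with hb | hb
      · have : (1:ℝ) ≤ Real.exp (-2 * t ^ 2 + -(1 / t) * (2 * (H.card : ℝ) - n)) := by
          apply Real.one_le_exp
          have := mul_nonneg hi (show 0 ≤ (n : ℝ) - 2 * H.card - 2 * t ^ 3 by linarith)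
          nlinarith
        have := Real.exp_pos (-2 * t ^ 2 + (1 / t) * (2 * (H.card : ℝ) - n))
        linarith
      · have : (1:ℝ) ≤ Real.exp (-2 * t ^ 2 + (1 / t) * (2 * (H.card : ℝ) - n)) := by
          apply Real.one_le_exp
          have := mul_nonneg hi (show 0 ≤ 2 * H.card - (n : ℝ) - 2 * t ^ 3 by linarith)
          nlinarith
        have := Real.exp_pos (-2 * t ^ 2 + -(1 / t) * (2 * (H.card : ℝ) - n))
        linarith
    · positivity
  refine (Finset.sum_le_sum fun H _ => hpt H).trans ?_
  rw [← Finset.mul_sum, Finset.sum_add_distrib]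
  have h1 := mgf_sum n (1 / t)
  have h2 := mgf_sum n (-(1 / t))
  have e1 : (n : ℝ) * ((1 / t) ^ 2 / 2) = t ^ 2 / 2 := by rw [hn]; field_simp
  rw [neg_sq, e1] at h2
  rw [e1] at h1
  have h3 : Real.exp (-2 * t ^ 2) * Real.exp (t ^ 2 / 2) ≤ Real.exp (-t / 4) := by
    rw [← Real.exp_add]
    apply Real.exp_le_exp.mpr
    nlinarith
  calc _ ≤ Real.exp (-2 * t ^ 2) * (2 ^ n * Real.exp (t ^ 2 / 2) + 2 ^ n * Real.exp (t ^ 2 / 2)) := by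
        gcongr
    _ = 2 ^ n * (2 * (Real.exp (-2 * t ^ 2) * Real.exp (t ^ 2 / 2))) := by ring
    _ ≤ _ := by gcongr

/-- Number of fast agents allocated `1`. -/
def cnt {n : ℕ} (H : Finset (Fin n)) (x : Fin n → ℝ) : ℝ := ∑ i ∈ H, ind (x i = 1)

lemma cnt_eq {n : ℕ} (H : Finset (Fin n)) (x : Fin n → ℝ) :
    cnt H x = ((H.filter fun i => x i = 1).card : ℝ) := by
  unfold cnt ind
  rw [Finset.sum_boole]

lemma cnt_le {n : ℕ} (H : Finset (Fin n)) (x : Fin n → ℝ) : cnt H x ≤ n := by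
  rw [cnt_eq]
  have := Finset.card_le_univ (H.filter fun i => x i = 1)
  simp only [Fintype.card_fin] at this
  exact_mod_cast this

lemma cnt_good {n : ℕ} (α t : ℝ) (hα : 1 ≤ α) (ht : 4 < t) (hn : (n : ℝ) = t ^ 4)
    (h34 : (n : ℝ) ^ ((3 : ℝ) / 4) = t ^ 3)
    (H : Finset (Fin n)) (x : Fin n → ℝ) (hx : inFam α x)
    (hB : ¬ ∃ i, i ∉ H ∧ x i = α)
    (hU : ¬ (n : ℝ) ^ ((3 : ℝ) / 4) ≤
      ((Finset.univ.filter (fun i : Fin n => i ∉ H ∧ x i = 0)).card : ℝ))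
    (hC : ¬ badC t H) : cnt H x ≤ 3 * t ^ 3 := by
  rw [cnt_eq]
  push Not at hB hU
  rw [h34] at hU
  unfold badC at hC
  rw [not_not] at hC
  unfold inFam at hx
  rw [h34] at hx
  have ht3 : 0 < t ^ 3 := by positivity
  rcases hx with ⟨H', S, hS, h1, h2, h3, hx⟩ | ⟨S, hS, hx⟩
  · by_cases ha : α = 1
    · exfalso
      have hsub : Hᶜ ⊆ Finset.univ.filter (fun i : Fin n => i ∉ H ∧ x i = 0) := by
        intro i hi
        rw [Finset.mem_compl] at hi
        have hne := hB i hi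
        have hxi := hx i
        simp only [Finset.mem_filter, Finset.mem_univ, true_and]
        refine ⟨hi, ?_⟩
        split_ifs at hxi with h h'
        · exact absurd hxi hne
        · exact hxi
        · exact absurd (hxi.trans ha.symm) hne
      have hc := Finset.card_le_card hsub
      have hcc := Finset.card_add_card_compl H
      rw [Fintype.card_fin] at hcc
      have hc' : ((Hᶜ).card : ℝ) ≤ _ := Nat.cast_le.mpr hc
      have hcc' : (H.card : ℝ) + ((Hᶜ).card : ℝ) = n := by exact_mod_cast hcc
      have : t ^ 4 = t * t ^ 3 := by ring
      nlinarith [hC.2]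
    · have s1 : (H.filter fun i => x i = 1) ⊆ H \ H' := by
        intro i hi
        rw [Finset.mem_filter] at hi
        rw [Finset.mem_sdiff]
        refine ⟨hi.1, fun hm => ?_⟩
        have hxi := hx i
        rw [hi.2, if_pos hm] at hxi
        split_ifs at hxi
        · exact ha hxi.symm
        · norm_num at hxi
      have s2 : H' \ H ⊆ Finset.univ.filter (fun i : Fin n => i ∉ H ∧ x i = 0) := by
        intro i hi
        rw [Finset.mem_sdiff] at hi
        have hne := hB i hi.2
        have hxi := hx i
        rw [if_pos hi.1] at hxi
        simp only [Finset.mem_filter, Finset.mem_univ, true_and]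
        refine ⟨hi.2, ?_⟩
        split_ifs at hxi
        · exact absurd hxi hne
        · exact hxi
      have c1 : ((H.filter fun i => x i = 1).card : ℝ) ≤ ((H \ H').card : ℝ) :=
        Nat.cast_le.mpr (Finset.card_le_card s1)
      have c2 : ((H' \ H).card : ℝ) ≤ _ := Nat.cast_le.mpr (Finset.card_le_card s2)
      have e1 := Finset.card_sdiff_add_card_inter H H'
      have e2 := Finset.card_sdiff_add_card_inter H' H
      rw [Finset.inter_comm] at e2
      have e1' : ((H \ H').card : ℝ) + ((H ∩ H').card : ℝ) = H.card := by exact_mod_cast e1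
      have e2' : ((H' \ H).card : ℝ) + ((H ∩ H').card : ℝ) = H'.card := by exact_mod_cast e2
      linarith [hC.2]
  · have s1 : (H.filter fun i => x i = 1) ⊆ S := by
      intro i hi
      rw [Finset.mem_filter] at hi
      by_contra hm
      have hxi := hx i
      rw [hi.2, if_neg hm] at hxi
      norm_num at hxi
    have c1 : ((H.filter fun i => x i = 1).card : ℝ) ≤ (S.card : ℝ) :=
        Nat.cast_le.mpr (Finset.card_le_card s1)
    linarith

lemma lhs_eq {n : ℕ} (hn : 0 < n) {Ω : Type} [Fintype Ω] (μ : Ω → ℝ)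
    (M : Finset (Fin n) → Ω → Fin n → ℝ) :
    (1 / (2 * (n : ℝ))) * ∑ i : Fin n, pHigh μ M i 1 =
      (∑ H : Finset (Fin n), ∑ ω : Ω, μ ω * (cnt H (M H ω) / n)) / 2 ^ n := by
  obtain ⟨m, rfl⟩ : ∃ m, n = m + 1 := ⟨n - 1, by omega⟩
  have key : ∑ i : Fin (m + 1), ∑ H ∈ Finset.univ.filter (fun H : Finset (Fin (m + 1)) => i ∈ H),
      ∑ ω : Ω, μ ω * ind (M H ω i = 1) =
      ∑ H : Finset (Fin (m + 1)), ∑ ω : Ω, μ ω * cnt H (M H ω) := by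
    simp_rw [Finset.sum_filter]
    rw [Finset.sum_comm]
    refine Finset.sum_congr rfl fun H _ => ?_
    rw [← Finset.sum_filter, Finset.sum_comm]
    refine Finset.sum_congr rfl fun ω _ => ?_
    rw [← Finset.mul_sum, cnt]
    congr 2
    ext i; simp
  unfold pHigh
  rw [← Finset.sum_div, key]
  simp_rw [← mul_div_assoc]
  simp_rw [← Finset.sum_div]
  rw [Nat.add_sub_cancel, pow_succ]
  field_simp

theorem stmt11 (n : ℕ) (α : ℝ) (hα : 1 ≤ α)
    (Ω : Type) [Fintype Ω] (μ : Ω → ℝ)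
    (hμ0 : ∀ ω, 0 ≤ μ ω) (hμ1 : ∑ ω, μ ω = 1)
    (M : Finset (Fin n) → Ω → Fin n → ℝ)
    (hfam : ∀ H ω, inFam α (M H ω))
    (hU : ∀ H : Finset (Fin n),
      (∑ ω : Ω, μ ω * ind (Uev M H ω ∧ ¬Bev α M H ω))
        ≤ Real.log 4 * Real.exp (-(n : ℝ) ^ ((1 : ℝ) / 4) / 2)) :
    (1 / (2 * (n : ℝ))) * ∑ i : Fin n, pHigh μ M i 1
      ≤ 3 * (n : ℝ) ^ (-(1 : ℝ) / 4) + prB α μ M +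
        Real.log 4 * Real.exp (-(n : ℝ) ^ ((1 : ℝ) / 4) / 2) +
        2 * Real.exp (-(n : ℝ) ^ ((1 : ℝ) / 4) / 4) := by
  have hlog : 0 ≤ Real.log 4 := Real.log_nonneg (by norm_num)
  have hprB : 0 ≤ prB α μ M := by
    unfold prB
    apply div_nonneg _ (by positivity)
    exact Finset.sum_nonneg fun H _ => Finset.sum_nonneg fun ω _ =>
      mul_nonneg (hμ0 ω) (ind_nonneg' _)
  rcases Nat.eq_zero_or_pos n with h0 | hpos
  · subst h0
    simp only [Finset.univ_eq_empty, Finset.sum_empty, mul_zero]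
    positivity
  rw [lhs_eq hpos]
  have hnR : (0 : ℝ) < n := by exact_mod_cast hpos
  have hn1 : (1 : ℝ) ≤ n := by exact_mod_cast hpos
  obtain ⟨t, ht⟩ : ∃ t : ℝ, t = (n : ℝ) ^ ((1 : ℝ) / 4) := ⟨_, rfl⟩
  have ht1 : 1 ≤ t := by rw [ht]; exact Real.one_le_rpow hn1 (by norm_num)
  have ht0 : 0 < t := by linarith
  have hn : (n : ℝ) = t ^ 4 := by
    rw [ht, ← Real.rpow_natCast, ← Real.rpow_mul hnR.le]; norm_num
  have h34 : (n : ℝ) ^ ((3 : ℝ) / 4) = t ^ 3 := by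
    rw [ht, ← Real.rpow_natCast, ← Real.rpow_mul hnR.le]; norm_num
  have hm : (n : ℝ) ^ (-(1 : ℝ) / 4) = 1 / t := by
    rw [ht, neg_div, Real.rpow_neg hnR.le, one_div ((n : ℝ) ^ _)]
  rw [hm, ← ht]
  rw [← ht] at hU
  have h2n : (0 : ℝ) < 2 ^ n := by positivity
  have hcard : ∑ _H : Finset (Fin n), (1 : ℝ) = 2 ^ n := by
    simp
  by_cases h4 : t ≤ 4
  · have hle : (∑ H : Finset (Fin n), ∑ ω : Ω, μ ω * (cnt H (M H ω) / n)) / 2 ^ n ≤ 1 := by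
      rw [div_le_one h2n, ← hcard]
      refine Finset.sum_le_sum fun H _ => ?_
      rw [← hμ1]
      refine Finset.sum_le_sum fun ω _ => ?_
      exact mul_le_of_le_one_right (hμ0 ω) ((div_le_one hnR).mpr (cnt_le _ _))
    have a1 : 3 / 4 ≤ 3 * (1 / t) := by
      rw [mul_one_div, div_le_div_iff₀ (by norm_num) ht0]; linarith
    have a2 : Real.exp (-1) ≤ Real.exp (-t / 4) := Real.exp_le_exp.mpr (by linarith)
    have a3 : (1 : ℝ) / 3 ≤ Real.exp (-1) := by
      rw [Real.exp_neg, one_div]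
      apply inv_anti₀ (Real.exp_pos 1)
      linarith [Real.exp_one_lt_d9]
    have a4 : 0 ≤ Real.log 4 * Real.exp (-t / 2) := by positivity
    linarith
  push Not at h4
  have hpt : ∀ H ω, cnt H (M H ω) / n ≤ 3 * (1 / t) + ind (Bev α M H ω) +
      ind (Uev M H ω ∧ ¬Bev α M H ω) + ind (badC t H) := by
    intro H ω
    have one : cnt H (M H ω) / n ≤ 1 := (div_le_one hnR).mpr (cnt_le _ _)
    have q0 : 0 ≤ 3 * (1 / t) := by positivity
    have q1 := ind_nonneg' (Bev α M H ω)
    have q2 := ind_nonneg' (Uev M H ω ∧ ¬Bev α M H ω)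
    have q3 := ind_nonneg' (badC t H)
    by_cases b : Bev α M H ω
    · have : ind (Bev α M H ω) = 1 := if_pos b
      linarith
    by_cases u : Uev M H ω
    · have : ind (Uev M H ω ∧ ¬Bev α M H ω) = 1 := if_pos ⟨u, b⟩
      linarith
    by_cases c : badC t H
    · have : ind (badC t H) = 1 := if_pos c
      linarith
    have := cnt_good α t hα h4 hn h34 H (M H ω) (hfam H ω) b u c
    have : cnt H (M H ω) / n ≤ 3 * (1 / t) := by
      rw [div_le_iff₀ hnR, hn]
      calc _ ≤ 3 * t ^ 3 := this
        _ = _ := by field_simp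
    linarith
  have hsum : ∀ H, ∑ ω : Ω, μ ω * (cnt H (M H ω) / n) ≤
      3 * (1 / t) + (∑ ω : Ω, μ ω * ind (Bev α M H ω)) +
        Real.log 4 * Real.exp (-t / 2) + ind (badC t H) := by
    intro H
    calc _ ≤ ∑ ω : Ω, μ ω * (3 * (1 / t) + ind (Bev α M H ω) +
          ind (Uev M H ω ∧ ¬Bev α M H ω) + ind (badC t H)) :=
          Finset.sum_le_sum fun ω _ => mul_le_mul_of_nonneg_left (hpt H ω) (hμ0 ω)
      _ = 3 * (1 / t) + (∑ ω : Ω, μ ω * ind (Bev α M H ω)) +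
          (∑ ω : Ω, μ ω * ind (Uev M H ω ∧ ¬Bev α M H ω)) + ind (badC t H) := by
          simp_rw [mul_add, Finset.sum_add_distrib, ← Finset.sum_mul, hμ1, one_mul]
      _ ≤ _ := by linarith [hU H]
  rw [div_le_iff₀ h2n]
  refine (Finset.sum_le_sum fun H _ => hsum H).trans ?_
  simp only [Finset.sum_add_distrib]
  have hb := badC_sum n t ht1 hn
  have hconst : ∀ c : ℝ, ∑ _H : Finset (Fin n), c = c * 2 ^ n := by
    intro c
    rw [← hcard, Finset.mul_sum]; simp
  rw [hconst, hconst]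
  have hB : prB α μ M * 2 ^ n = ∑ H : Finset (Fin n), ∑ ω : Ω, μ ω * ind (Bev α M H ω) := by
    unfold prB
    exact div_mul_cancel₀ _ h2n.ne'
  rw [add_mul, add_mul, add_mul, hB]
  linarith
end
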